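/- With S₁, S₂, f₁, f₂, a, f, R, k, D as above (k | D, f ≤ D(1-2/k), f ≥ 2), the probability that two fixed distinct bins are both matched equals R·((a-1)/(f-1))·(1 - 2∏_{j=0}^{f-1}(D(1-1/k)-j)/(D-j) + ∏_{j=0}^{f-1}(D(1-2/k)-j)/(D-j)). -/

import Mathlib

open scoped BigOperators Classical

/-- Restriction of the hashed set `S` to the `j`-th of `k` equal consecutive bins of
`{0,...,D-1}` (each bin has length `D/k`). -/
def hashBin (D k : ℕ) (S : Finset (Fin D)) (j : ℕ) : Finset (Fin D) :=
  S.filter (fun x => x.val / (D / k) = j)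

/-- The `j`-th bin is matched: both `π(S₁)` and `π(S₂)` are nonempty in the bin and
their smallest elements in the bin coincide. -/
def matchedBin (D k : ℕ) (π : Equiv.Perm (Fin D)) (S₁ S₂ : Finset (Fin D)) (j : ℕ) : Prop :=
  (hashBin D k (S₁.image π) j).Nonempty ∧ (hashBin D k (S₂.image π) j).Nonempty ∧
    (hashBin D k (S₁.image π) j).min = (hashBin D k (S₂.image π) j).min

/-- The number of matched bins. -/
noncomputable def Nmat (D k : ℕ) (π : Equiv.Perm (Fin D)) (S₁ S₂ : Finset (Fin D)) : ℕ :=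
  ((Finset.range k).filter (fun j => matchedBin D k π S₁ S₂ j)).card

/-- The number of jointly empty bins: bins where both `π(S₁)` and `π(S₂)` are empty. -/
noncomputable def NempJ (D k : ℕ) (π : Equiv.Perm (Fin D)) (S₁ S₂ : Finset (Fin D)) : ℕ :=
  ((Finset.range k).filter (fun j =>
    hashBin D k (S₁.image π) j = ∅ ∧ hashBin D k (S₂.image π) j = ∅)).card

/-- `x` is the element of `U` whose image under `π` is the smallest one in the class `b` of `β`. -/
def IsBinArgmin {α : Type*} [LE α] (β : α → ℕ) (U : Finset α) (b : ℕ) (x : α)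
    (π : Equiv.Perm α) : Prop :=
  x ∈ U ∧ β (π x) = b ∧ ∀ z ∈ U, β (π z) = b → π x ≤ π z

section

variable {α : Type*} [LinearOrder α] {β : α → ℕ} {U : Finset α} {b : ℕ} {x y : α}
  {π : Equiv.Perm α}

theorem IsBinArgmin.unique (hx : IsBinArgmin β U b x π) (hy : IsBinArgmin β U b y π) : x = y :=
  π.injective (le_antisymm (hx.2.2 y hy.1 hy.2.1) (hy.2.2 x hx.1 hx.2.1))

theorem exists_isBinArgmin_iff :
    (∃ x ∈ U, IsBinArgmin β U b x π) ↔ ∃ x ∈ U, β (π x) = b := by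
  constructor
  · rintro ⟨x, hx, h⟩
    exact ⟨x, hx, h.2.1⟩
  · rintro ⟨x, hx, h⟩
    obtain ⟨y, hy, hmin⟩ := (U.filter (fun z => β (π z) = b)).exists_min_image π
      ⟨x, by simp [hx, h]⟩
    rw [Finset.mem_filter] at hy
    exact ⟨y, hy.1, hy.1, hy.2, fun z hz hzb => hmin z (by simp [hz, hzb])⟩

theorem IsBinArgmin.mul_of_mem_iff {σ : Equiv.Perm α} (hσ : ∀ z, σ z ∈ U ↔ z ∈ U)
    (h : IsBinArgmin β U b (σ x) π) : IsBinArgmin β U b x (π * σ) :=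
  ⟨(hσ x).1 h.1, h.2.1, fun z hz hzb => h.2.2 (σ z) ((hσ z).2 hz) hzb⟩

end

theorem swap_mem_iff {α : Type*} {U : Finset α} {x y : α} (hx : x ∈ U) (hy : y ∈ U) (z : α) :
    Equiv.swap x y z ∈ U ↔ z ∈ U := by
  rw [Equiv.swap_apply_def]
  split_ifs <;> simp_all

theorem exists_perm_map_pair {α : Type*} {U : Finset α} {x y x' y' : α} (hx : x ∈ U)
    (hy : y ∈ U) (hx' : x' ∈ U) (hy' : y' ∈ U) (hxy : x ≠ y) (hxy' : x' ≠ y') :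
    ∃ σ : Equiv.Perm α, (∀ z, σ z ∈ U ↔ z ∈ U) ∧ σ x = x' ∧ σ y = y' := by
  refine ⟨Equiv.swap (Equiv.swap x x' y) y' * Equiv.swap x x', fun z => ?_, ?_, ?_⟩
  · rw [Equiv.Perm.mul_apply, swap_mem_iff ((swap_mem_iff hx hx' y).2 hy) hy',
      swap_mem_iff hx hx']
  · rw [Equiv.Perm.mul_apply, Equiv.swap_apply_left]
    refine Equiv.swap_apply_of_ne_of_ne (fun h => hxy ?_) hxy'
    apply (Equiv.swap x x').injective
    rw [← h, Equiv.swap_apply_left]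
  · rw [Equiv.Perm.mul_apply, Equiv.swap_apply_left]

section

variable {α : Type*} [LinearOrder α] [Fintype α]

theorem card_isBinArgmin_pair_le (β : α → ℕ) {U : Finset α} (b₁ b₂ : ℕ) {x y x' y' : α}
    (hx : x ∈ U) (hy : y ∈ U) (hx' : x' ∈ U) (hy' : y' ∈ U) (hxy : x ≠ y) (hxy' : x' ≠ y') :
    (Finset.univ.filter (fun π : Equiv.Perm α =>
        IsBinArgmin β U b₁ x π ∧ IsBinArgmin β U b₂ y π)).card ≤
      (Finset.univ.filter (fun π : Equiv.Perm α =>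
        IsBinArgmin β U b₁ x' π ∧ IsBinArgmin β U b₂ y' π)).card := by
  obtain ⟨σ, hσ, rfl, rfl⟩ := exists_perm_map_pair hx' hy' hx hy hxy' hxy
  refine Finset.card_le_card_of_injOn (fun π => π * σ) (fun π hπ => ?_)
    (fun _ _ _ _ h => mul_right_cancel h)
  simp only [Finset.coe_filter, Finset.mem_univ, true_and, Set.mem_ofPred_eq] at hπ ⊢
  exact ⟨hπ.1.mul_of_mem_iff hσ, hπ.2.mul_of_mem_iff hσ⟩

theorem card_exists_isBinArgmin_pair (β : α → ℕ) {U A : Finset α} {b₁ b₂ N : ℕ} (hb : b₁ ≠ b₂)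
    (hN : ∀ x ∈ A, ∀ y ∈ A, x ≠ y → (Finset.univ.filter (fun π : Equiv.Perm α =>
      IsBinArgmin β U b₁ x π ∧ IsBinArgmin β U b₂ y π)).card = N)
    {H : Finset (Equiv.Perm α)} (hH : ∀ π, π ∈ H ↔
      (∃ x ∈ A, IsBinArgmin β U b₁ x π) ∧ ∃ y ∈ A, IsBinArgmin β U b₂ y π) :
    H.card = (A.card * A.card - A.card) * N := by
  have key : H = A.offDiag.biUnion (fun p => Finset.univ.filter (fun π : Equiv.Perm α =>
        IsBinArgmin β U b₁ p.1 π ∧ IsBinArgmin β U b₂ p.2 π)) := by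
    ext π
    simp only [hH, Finset.mem_filter, Finset.mem_univ, true_and, Finset.mem_biUnion,
      Finset.mem_offDiag, Prod.exists]
    constructor
    · rintro ⟨⟨x, hx, h₁⟩, y, hy, h₂⟩
      refine ⟨x, y, ⟨hx, hy, ?_⟩, h₁, h₂⟩
      rintro rfl
      exact hb (h₁.2.1.symm.trans h₂.2.1)
    · rintro ⟨x, y, ⟨hx, hy, -⟩, h₁, h₂⟩
      exact ⟨⟨x, hx, h₁⟩, y, hy, h₂⟩
  rw [key, Finset.card_biUnion, Finset.sum_const_nat (m := N), Finset.offDiag_card]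
  · rintro ⟨x, y⟩ hp
    rw [Finset.mem_offDiag] at hp
    exact hN x hp.1 y hp.2.1 hp.2.2
  · rintro ⟨x, y⟩ - ⟨x', y'⟩ - hne
    refine Finset.disjoint_left.2 fun π h h' => ?_
    simp only [Finset.mem_filter, Finset.mem_univ, true_and] at h h'
    exact hne (Prod.ext (h.1.unique h'.1) (h.2.unique h'.2))

end

theorem card_perm_image_subset_le {α : Type*} [Fintype α] [DecidableEq α] (T : Finset α) {U V : Finset α}
    (h : U.card = V.card) :
    (Finset.univ.filter (fun π : Equiv.Perm α => U.image π ⊆ T)).card ≤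
      (Finset.univ.filter (fun π : Equiv.Perm α => V.image π ⊆ T)).card := by
  obtain ⟨σ, rfl⟩ : ∃ σ : Equiv.Perm α, V.image σ = U := by
    let e : V ≃ U := Finset.equivOfCardEq h.symm
    refine ⟨e.extendSubtype, Finset.eq_of_subset_of_card_le ?_ ?_⟩
    · intro y hy
      obtain ⟨x, hx, rfl⟩ := Finset.mem_image.1 hy
      exact e.extendSubtype_mem x hx
    · rw [Finset.card_image_of_injective _ (Equiv.injective _), h]
  refine Finset.card_le_card_of_injOn (fun π => π * σ) (fun π hπ => ?_)
    (fun _ _ _ _ h => mul_right_cancel h)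
  simpa [Finset.image_image] using hπ

theorem card_perm_image_subset_mul_choose {α : Type*} [Fintype α] [DecidableEq α] (T U : Finset α) :
    (Finset.univ.filter (fun π : Equiv.Perm α => U.image π ⊆ T)).card *
        (Fintype.card α).choose U.card =
      Fintype.card (Equiv.Perm α) * T.card.choose U.card := by
  have h := Finset.sum_card_bipartiteAbove_eq_sum_card_bipartiteBelow
    (s := Finset.powersetCard U.card (Finset.univ : Finset α))
    (t := (Finset.univ : Finset (Equiv.Perm α))) (fun V π => V.image π ⊆ T)
  rw [Finset.sum_const_nat (m := (Finset.univ.filter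
      (fun π : Equiv.Perm α => U.image π ⊆ T)).card),
    Finset.sum_const_nat (m := T.card.choose U.card)] at h
  · rw [Finset.card_powersetCard, Finset.card_univ, Finset.card_univ] at h
    rw [mul_comm, h]
  · intro π _
    rw [← Finset.card_powersetCard]
    refine Finset.card_nbij' (fun V => V.image π) (fun W => W.image π.symm) ?_ ?_ ?_ ?_
    · intro V hV
      simp only [Finset.bipartiteBelow, Finset.coe_filter, Finset.mem_powersetCard_univ,
        Set.mem_ofPred_eq] at hV
      simp [Finset.mem_powersetCard, hV.2, Finset.card_image_of_injective, π.injective, hV.1]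
    · intro W hW
      rw [Finset.mem_coe, Finset.mem_powersetCard] at hW
      simp [Finset.bipartiteBelow, Finset.image_image, Finset.card_image_of_injective,
        π.symm.injective, hW.1, hW.2]
    · intro V _
      simp [Finset.image_image]
    · intro W _
      simp [Finset.image_image]
  · intro V hV
    rw [Finset.mem_powersetCard_univ] at hV
    exact le_antisymm (card_perm_image_subset_le T hV) (card_perm_image_subset_le T hV.symm)

theorem card_perm_image_subset_div {α : Type*} [Fintype α] [DecidableEq α] (T U : Finset α)
    (h : U.card ≤ T.card) :
    ((Finset.univ.filter (fun π : Equiv.Perm α => U.image π ⊆ T)).card : ℝ) /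
        Fintype.card (Equiv.Perm α) =
      ∏ j ∈ Finset.range U.card, (((T.card : ℝ) - j) / ((Fintype.card α : ℝ) - j)) := by
  have cast_desc : ∀ n : ℕ, U.card ≤ n →
      ∏ j ∈ Finset.range U.card, ((n : ℝ) - j) = U.card.factorial * n.choose U.card := by
    intro n hn
    rw [← Nat.cast_mul, ← Nat.descFactorial_eq_factorial_mul_choose,
      Nat.descFactorial_eq_prod_range, Nat.cast_prod]
    refine Finset.prod_congr rfl fun j hj => ?_
    rw [Nat.cast_sub ((Finset.mem_range.1 hj).le.trans hn)]
  have hU : U.card ≤ Fintype.card α := U.card_le_univ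
  have hpos : ((Fintype.card α).choose U.card : ℝ) ≠ 0 :=
    Nat.cast_ne_zero.2 (Nat.choose_pos hU).ne'
  have hfac : (U.card.factorial : ℝ) ≠ 0 := Nat.cast_ne_zero.2 (Nat.factorial_ne_zero _)
  have hperm : (Fintype.card (Equiv.Perm α) : ℝ) ≠ 0 := Nat.cast_ne_zero.2 Fintype.card_ne_zero
  rw [Finset.prod_div_distrib, cast_desc _ h, cast_desc _ hU, mul_div_mul_left _ _ hfac,
    div_eq_div_iff hperm hpos]
  have := card_perm_image_subset_mul_choose T U
  rw [mul_comm (T.card.choose U.card : ℝ)]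
  exact_mod_cast this

theorem card_filter_div_eq {D m b : ℕ} (hm : 0 < m) (hb : (b + 1) * m ≤ D) :
    ((Finset.univ : Finset (Fin D)).filter (fun x => x.val / m = b)).card = m := by
  rw [← Finset.card_map Fin.valEmbedding]
  have : (Finset.univ.filter (fun x : Fin D => x.val / m = b)).map Fin.valEmbedding =
      Finset.Ico (b * m) ((b + 1) * m) := by
    ext n
    simp only [Finset.mem_map, Finset.mem_filter, Finset.mem_univ, true_and,
      Fin.valEmbedding_apply, Finset.mem_Ico]
    constructor
    · rintro ⟨x, rfl, rfl⟩
      exact ⟨Nat.div_mul_le_self _ _, Nat.lt_mul_of_div_lt (Nat.lt_succ_self (x.val / m)) hm⟩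
    · intro hn
      exact ⟨⟨n, hn.2.trans_le hb⟩, Nat.div_eq_of_lt_le hn.1 hn.2, rfl⟩
  rw [this, Nat.card_Ico, add_mul, one_mul, Nat.add_sub_cancel_left]

theorem matchedBin_iff {D k : ℕ} {π : Equiv.Perm (Fin D)} {S₁ S₂ : Finset (Fin D)} {b : ℕ} :
    matchedBin D k π S₁ S₂ b ↔ ∃ x ∈ S₁ ∩ S₂,
      IsBinArgmin (fun i : Fin D => i.val / (D / k)) (S₁ ∪ S₂) b x π := by
  constructor
  · rintro ⟨h₁, h₂, h⟩
    obtain ⟨y, hy⟩ := Finset.min_of_nonempty h₁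
    have hy' := h ▸ hy
    have m₁ := Finset.mem_of_min hy
    have m₂ := Finset.mem_of_min hy'
    simp only [hashBin, Finset.mem_filter, Finset.mem_image] at m₁ m₂
    obtain ⟨⟨x, hx, rfl⟩, hb⟩ := m₁
    obtain ⟨⟨x', hx', hxx⟩, -⟩ := m₂
    obtain rfl := π.injective hxx
    refine ⟨x', Finset.mem_inter.2 ⟨hx, hx'⟩, Finset.mem_union_left _ hx, hb, fun z hz hzb => ?_⟩
    rcases Finset.mem_union.1 hz with hz | hz
    · exact Finset.min_le_of_eq (Finset.mem_filter.2 ⟨Finset.mem_image_of_mem _ hz, hzb⟩) hy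
    · exact Finset.min_le_of_eq (Finset.mem_filter.2 ⟨Finset.mem_image_of_mem _ hz, hzb⟩) hy'
  · rintro ⟨x, hx, -, hb, hmin⟩
    have min_eq : ∀ S ⊆ S₁ ∪ S₂, x ∈ S → (hashBin D k (S.image π) b).min = (π x : Fin D) := by
      intro S hS hxS
      refine le_antisymm (Finset.min_le ?_) (Finset.le_min ?_)
      · exact Finset.mem_filter.2 ⟨Finset.mem_image_of_mem _ hxS, hb⟩
      · intro y hy
        simp only [hashBin, Finset.mem_filter, Finset.mem_image] at hy
        obtain ⟨⟨z, hz, rfl⟩, hzb⟩ := hy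
        exact WithTop.coe_le_coe.2 (hmin z (hS hz) hzb)
    rw [Finset.mem_inter] at hx
    refine ⟨⟨π x, Finset.mem_filter.2 ⟨Finset.mem_image_of_mem _ hx.1, hb⟩⟩,
      ⟨π x, Finset.mem_filter.2 ⟨Finset.mem_image_of_mem _ hx.2, hb⟩⟩, ?_⟩
    rw [min_eq S₁ Finset.subset_union_left hx.1, min_eq S₂ Finset.subset_union_right hx.2]

theorem card_both_classes_hit {α : Type*} [Fintype α] [DecidableEq α] (β : α → ℕ) (U : Finset α)
    (b₁ b₂ : ℕ) {H : Finset (Equiv.Perm α)}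
    (hH : ∀ π, π ∈ H ↔ (∃ x ∈ U, β (π x) = b₁) ∧ ∃ x ∈ U, β (π x) = b₂) :
    (H.card : ℝ) =
      Fintype.card (Equiv.Perm α)
        - (Finset.univ.filter (fun π : Equiv.Perm α =>
            U.image π ⊆ Finset.univ.filter (fun i => β i ≠ b₁))).card
        - (Finset.univ.filter (fun π : Equiv.Perm α =>
            U.image π ⊆ Finset.univ.filter (fun i => β i ≠ b₂))).card
        + (Finset.univ.filter (fun π : Equiv.Perm α =>
            U.image π ⊆ Finset.univ.filter (fun i => β i ≠ b₁ ∧ β i ≠ b₂))).card := by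
  set X₁ := Finset.univ.filter (fun π : Equiv.Perm α =>
    U.image π ⊆ Finset.univ.filter (fun i => β i ≠ b₁)) with hX₁
  set X₂ := Finset.univ.filter (fun π : Equiv.Perm α =>
    U.image π ⊆ Finset.univ.filter (fun i => β i ≠ b₂)) with hX₂
  have hinter : Finset.univ.filter (fun π : Equiv.Perm α =>
      U.image π ⊆ Finset.univ.filter (fun i => β i ≠ b₁ ∧ β i ≠ b₂)) = X₁ ∩ X₂ := by
    rw [hX₁, hX₂, ← Finset.filter_and]
    simp only [Finset.filter_and, Finset.subset_inter_iff]
  have hcompl : Hᶜ = X₁ ∪ X₂ := by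
    ext π
    simp only [Finset.mem_compl, hH, not_and_or, not_exists, Finset.mem_union, hX₁, hX₂,
      Finset.mem_filter, Finset.mem_univ, true_and, Finset.image_subset_iff, ne_eq,
      imp_iff_not_or]
  have h := Finset.card_union_add_card_inter X₁ X₂
  have h' := H.card_add_card_compl
  rw [hcompl] at h'
  rw [hinter]
  have h₁ : ((X₁ ∪ X₂).card : ℝ) + (X₁ ∩ X₂).card = X₁.card + X₂.card := by exact_mod_cast h
  have h₂ : (H.card : ℝ) + (X₁ ∪ X₂).card = Fintype.card (Equiv.Perm α) := by exact_mod_cast h'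
  linarith

/-- Probability that two fixed distinct bins are both matched:
`R·((a-1)/(f-1))·(1 - 2P₁ + P₂)` where `P₁, P₂` are the one- and two-bin avoidance
probabilities. -/
theorem stmt_8 (D k f₁ f₂ a f : ℕ) (R : ℝ) (hk : 2 ≤ k) (hkD : k ∣ D)
    (S₁ S₂ : Finset (Fin D)) (h₁ : S₁.card = f₁) (h₂ : S₂.card = f₂)
    (ha : (S₁ ∩ S₂).card = a) (hf : (S₁ ∪ S₂).card = f) (hfeq : f = f₁ + f₂ - a)
    (hf2 : 2 ≤ f) (hfD : f ≤ D - 2 * (D / k)) (hR : R = (a : ℝ) / f)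
    (b₁ b₂ : ℕ) (hb₁ : b₁ < k) (hb₂ : b₂ < k) (hne : b₁ ≠ b₂) :
    (((Finset.univ : Finset (Equiv.Perm (Fin D))).filter
          (fun π => matchedBin D k π S₁ S₂ b₁ ∧ matchedBin D k π S₁ S₂ b₂)).card : ℝ) /
        (Fintype.card (Equiv.Perm (Fin D)) : ℝ)
      = R * (((a : ℝ) - 1) / ((f : ℝ) - 1)) *
          (1 - 2 * ∏ j ∈ Finset.range f, (((D : ℝ) * (1 - 1 / k) - j) / ((D : ℝ) - j))
            + ∏ j ∈ Finset.range f, (((D : ℝ) * (1 - 2 / k) - j) / ((D : ℝ) - j))) := by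
  have hm : 0 < D / k := by
    rcases Nat.eq_zero_or_pos (D / k) with h | h
    · have := Nat.div_mul_cancel hkD
      rw [h] at this
      omega
    · exact h
  set m := D / k with hmdef
  have hD : k * m = D := Nat.mul_div_cancel' hkD
  set β : Fin D → ℕ := fun i => i.val / m with hβ
  have hbin : ∀ b < k, (Finset.univ.filter (fun i => β i = b)).card = m := fun b hb =>
    card_filter_div_eq hm (hD ▸ Nat.mul_le_mul_right m hb)
  have h2m : 2 * m ≤ D := hD ▸ Nat.mul_le_mul_right m hk
  have hone : ∀ b < k, (Finset.univ.filter (fun i => β i ≠ b)).card = D - m := by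
    intro b hb
    have := Finset.card_filter_add_card_filter_not (s := (Finset.univ : Finset (Fin D)))
      (fun i => β i = b)
    rw [hbin b hb, Finset.card_univ, Fintype.card_fin] at this
    simp only [ne_eq]
    omega
  have htwo : (Finset.univ.filter (fun i => β i ≠ b₁ ∧ β i ≠ b₂)).card = D - 2 * m := by
    have := Finset.card_filter_add_card_filter_not (s := (Finset.univ : Finset (Fin D)))
      (fun i => β i = b₁ ∨ β i = b₂)
    rw [Finset.filter_or, Finset.card_union_of_disjoint, hbin b₁ hb₁, hbin b₂ hb₂,
      Finset.card_univ, Fintype.card_fin] at this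
    · simp only [not_or] at this
      simp only [ne_eq]
      omega
    · exact Finset.disjoint_filter.2 fun i _ h h' => hne (h.symm.trans h')
  have hkR : (k : ℝ) ≠ 0 := by positivity
  have hDR : (D : ℝ) = k * m := by exact_mod_cast hD.symm
  have hone_cast : ((D - m : ℕ) : ℝ) = D * (1 - 1 / k) := by
    rw [Nat.cast_sub (by omega), hDR]
    field_simp
  have htwo_cast : ((D - 2 * m : ℕ) : ℝ) = D * (1 - 2 / k) := by
    rw [Nat.cast_sub h2m, hDR]
    push_cast
    field_simp
  have avoid_one : ∀ b < k, ((Finset.univ.filter (fun π : Equiv.Perm (Fin D) =>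
      (S₁ ∪ S₂).image π ⊆ Finset.univ.filter (fun i => β i ≠ b))).card : ℝ) /
        Fintype.card (Equiv.Perm (Fin D)) =
      ∏ j ∈ Finset.range f, (((D : ℝ) * (1 - 1 / k) - j) / ((D : ℝ) - j)) := by
    intro b hb
    rw [card_perm_image_subset_div _ _ (by rw [hone b hb]; omega), hone b hb, hf, hone_cast,
      Fintype.card_fin]
  have avoid_two : ((Finset.univ.filter (fun π : Equiv.Perm (Fin D) =>
      (S₁ ∪ S₂).image π ⊆ Finset.univ.filter (fun i => β i ≠ b₁ ∧ β i ≠ b₂))).card : ℝ) /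
        Fintype.card (Equiv.Perm (Fin D)) =
      ∏ j ∈ Finset.range f, (((D : ℝ) * (1 - 2 / k) - j) / ((D : ℝ) - j)) := by
    rw [card_perm_image_subset_div _ _ (by rw [htwo]; omega), htwo, hf, htwo_cast,
      Fintype.card_fin]
  obtain ⟨u, hu, v, hv, huv⟩ := Finset.one_lt_card.1 (show 1 < (S₁ ∪ S₂).card by omega)
  have hN : ∀ x ∈ S₁ ∪ S₂, ∀ y ∈ S₁ ∪ S₂, x ≠ y →
      (Finset.univ.filter (fun π : Equiv.Perm (Fin D) =>
        IsBinArgmin β (S₁ ∪ S₂) b₁ x π ∧ IsBinArgmin β (S₁ ∪ S₂) b₂ y π)).card =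
      (Finset.univ.filter (fun π : Equiv.Perm (Fin D) =>
        IsBinArgmin β (S₁ ∪ S₂) b₁ u π ∧ IsBinArgmin β (S₁ ∪ S₂) b₂ v π)).card :=
    fun x hx y hy hxy => le_antisymm
      (card_isBinArgmin_pair_le β b₁ b₂ hx hy hu hv hxy huv)
      (card_isBinArgmin_pair_le β b₁ b₂ hu hv hx hy huv hxy)
  have hsub : S₁ ∩ S₂ ⊆ S₁ ∪ S₂ := Finset.inter_subset_left.trans Finset.subset_union_left
  have hU := card_exists_isBinArgmin_pair β hne hN
    (H := Finset.univ.filter (fun π : Equiv.Perm (Fin D) =>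
      (∃ x ∈ S₁ ∪ S₂, β (π x) = b₁) ∧ ∃ x ∈ S₁ ∪ S₂, β (π x) = b₂))
    fun π => by simp only [Finset.mem_filter, Finset.mem_univ, true_and, exists_isBinArgmin_iff]
  have hA := card_exists_isBinArgmin_pair (A := S₁ ∩ S₂) β hne
    (fun x hx y hy => hN x (hsub hx) y (hsub hy))
    (H := Finset.univ.filter (fun π : Equiv.Perm (Fin D) =>
      matchedBin D k π S₁ S₂ b₁ ∧ matchedBin D k π S₁ S₂ b₂))
    fun π => by simp only [Finset.mem_filter, Finset.mem_univ, true_and, matchedBin_iff, hβ, hmdef]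
  have hhit := card_both_classes_hit β (S₁ ∪ S₂) b₁ b₂
    (H := Finset.univ.filter (fun π : Equiv.Perm (Fin D) =>
      (∃ x ∈ S₁ ∪ S₂, β (π x) = b₁) ∧ ∃ x ∈ S₁ ∪ S₂, β (π x) = b₂))
    fun π => by simp only [Finset.mem_filter, Finset.mem_univ, true_and]
  rw [hU, hf, Nat.cast_mul, Nat.cast_sub (Nat.le_mul_self f), Nat.cast_mul] at hhit
  rw [hA, ha, Nat.cast_mul, Nat.cast_sub (Nat.le_mul_self a), Nat.cast_mul, hR,
    ← avoid_two]
  have hperm : (Fintype.card (Equiv.Perm (Fin D)) : ℝ) ≠ 0 :=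
    Nat.cast_ne_zero.2 Fintype.card_ne_zero
  have hfR : (2 : ℝ) ≤ f := by exact_mod_cast hf2
  have hf0 : (f : ℝ) ≠ 0 := by positivity
  have hf1 : (f : ℝ) - 1 ≠ 0 := by linarith
  rw [two_mul]
  nth_rewrite 1 [← avoid_one b₁ hb₁]
  rw [← avoid_one b₂ hb₂]
  rw [← sub_sub, ← div_self hperm, ← sub_div, ← sub_div, ← add_div, ← hhit]
  field_simp
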